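/- Let β⃗ be sub-critical with fixed point p*, and let X ~ ERGM(β⃗) on 𝒢_n. There exists a constant C > 0 such that for all sufficiently large n and every edge i of K_n, |𝔼 X_i − p*| ≤ C √(log n) / √n. -/

import Mathlib

open Finset MeasureTheory Filter
open scoped ENNReal NNReal

namespace ERGM

/-- The set of edges of the complete graph on `Fin n`: non-diagonal unordered pairs. -/
abbrev EdgeSet (n : ℕ) : Type := {p : Sym2 (Fin n) // ¬ p.IsDiag}

/-- A configuration (graph on `n` vertices): an assignment of `true/false` to each edge. -/
abbrev Config (n : ℕ) : Type := EdgeSet n → Bool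

/-- The value of the configuration `x` on the (unordered) pair `{i,j}`; `false` for `i = j`. -/
noncomputable def edgeVal {n : ℕ} (x : Config n) (i j : Fin n) : Bool :=
  if h : (s(i, j) : Sym2 (Fin n)).IsDiag then false else x ⟨s(i, j), h⟩

/-- Real-valued indicator of presence of the edge `{i,j}` in `x`. -/
noncomputable def edgeInd {n : ℕ} (x : Config n) (i j : Fin n) : ℝ :=
  if edgeVal x i j = true then 1 else 0

open scoped Classical in
/-- Subgraph counting number `N_G(x)`: the number of copies of `G` in `x` (times the
number of automorphisms), i.e. the sum over injective `ψ` of the product of edge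
indicators (each edge indicator is idempotent, so counting ordered adjacent pairs
yields the same value as counting edges). -/
noncomputable def NG {n m : ℕ} (G : SimpleGraph (Fin m)) (x : Config n) : ℝ :=
  ∑ ψ : Fin m ↪ Fin n, ∏ a : Fin m, ∏ b : Fin m,
    if G.Adj a b then edgeInd x (ψ a) (ψ b) else 1

/-- The Hamiltonian `H(x) = Σ_i β_i N_{G_i}(x) / n^{|V_i|-2}`. -/
noncomputable def Hamiltonian {n s : ℕ} (V : Fin s → ℕ)
    (G : ∀ i, SimpleGraph (Fin (V i))) (β : Fin s → ℝ) (x : Config n) : ℝ :=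
  ∑ i, β i * NG (G i) x / (n : ℝ) ^ (V i - 2)

/-- The ERGM probability mass function `π(x) ∝ exp(H(x))`. -/
noncomputable def ergmProb {n s : ℕ} (V : Fin s → ℕ)
    (G : ∀ i, SimpleGraph (Fin (V i))) (β : Fin s → ℝ) (x : Config n) : ℝ :=
  Real.exp (Hamiltonian V G β x) / ∑ y : Config n, Real.exp (Hamiltonian V G β y)

/-- Expectation of `f` with respect to the mass function `w`. -/
noncomputable def expect {n : ℕ} (w : Config n → ℝ) (f : Config n → ℝ) : ℝ :=
  ∑ x : Config n, w x * f x

open scoped Classical in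
/-- Probability of the event `A` with respect to the mass function `w`. -/
noncomputable def prob {n : ℕ} (w : Config n → ℝ) (A : Config n → Prop) : ℝ :=
  ∑ x : Config n, if A x then w x else 0

/-- The number of edges `|E(G)|` of a finite graph. -/
noncomputable def numEdges {m : ℕ} (G : SimpleGraph (Fin m)) : ℕ := G.edgeSet.ncard

/-- `Ψ_β(p) = Σ_i 2 β_i |E_i| p^{|E_i|-1}`. -/
noncomputable def Psi {s : ℕ} (V : Fin s → ℕ) (G : ∀ i, SimpleGraph (Fin (V i)))
    (β : Fin s → ℝ) (p : ℝ) : ℝ :=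
  ∑ i, 2 * β i * (numEdges (G i) : ℝ) * p ^ (numEdges (G i) - 1)

/-- `Φ(u) = e^u / (1 + e^u)`. -/
noncomputable def Phi (u : ℝ) : ℝ := Real.exp u / (1 + Real.exp u)

/-- `φ_β(p) = Φ(Ψ_β(p))`. -/
noncomputable def phiFn {s : ℕ} (V : Fin s → ℕ) (G : ∀ i, SimpleGraph (Fin (V i)))
    (β : Fin s → ℝ) : ℝ → ℝ := fun p => Phi (Psi V G β p)

/-- `β` is sub-critical (high temperature) with fixed point `p`: `p` is the unique
solution of `φ_β(p) = p` and it satisfies `φ_β'(p) < 1`. -/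
def Subcritical {s : ℕ} (V : Fin s → ℕ) (G : ∀ i, SimpleGraph (Fin (V i)))
    (β : Fin s → ℝ) (p : ℝ) : Prop :=
  phiFn V G β p = p ∧ (∀ q : ℝ, phiFn V G β q = q → q = p) ∧
    deriv (phiFn V G β) p < 1

/-- The discrete derivative `∂_e H(x) = H(x_{e+}) - H(x_{e-})`. -/
noncomputable def dHam {n s : ℕ} (V : Fin s → ℕ) (G : ∀ i, SimpleGraph (Fin (V i)))
    (β : Fin s → ℝ) (e : EdgeSet n) (x : Config n) : ℝ :=
  Hamiltonian V G β (Function.update x e true) - Hamiltonian V G β (Function.update x e false)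

/-- Real-valued indicator `X_e` of presence of edge `e`. -/
noncomputable def edgeX {n : ℕ} (e : EdgeSet n) (x : Config n) : ℝ := if x e = true then 1 else 0

/-- Two edges of `K_n` share a vertex. -/
def ShareVertex {n : ℕ} (e f : EdgeSet n) : Prop := ∃ v : Fin n, v ∈ e.1 ∧ v ∈ f.1

section Resampling

variable {ι : Type*} [DecidableEq ι]

/-- Average `f` over a fresh value of the coordinate `e`, which is `true` with weight `q`. -/
def resample (q : ℝ) (e : ι) (f : (ι → Bool) → ℝ) (x : ι → Bool) : ℝ :=
  q * f (Function.update x e true) + (1 - q) * f (Function.update x e false)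

/-- Resample successively all the coordinates in a list. -/
def sweep (q : ℝ) (l : List ι) (f : (ι → Bool) → ℝ) : (ι → Bool) → ℝ :=
  l.foldr (resample q) f

@[simp] lemma sweep_nil (q : ℝ) (f : (ι → Bool) → ℝ) : sweep q [] f = f := rfl

lemma sweep_cons (q : ℝ) (e : ι) (l : List ι) (f : (ι → Bool) → ℝ) :
    sweep q (e :: l) f = resample q e (sweep q l f) := rfl

/-- The discrete derivative of `f` in the coordinate `e`. -/
def diffAt (e : ι) (f : (ι → Bool) → ℝ) (x : ι → Bool) : ℝ :=
  f (Function.update x e true) - f (Function.update x e false)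

lemma resample_mono {q : ℝ} (hq0 : 0 ≤ q) (hq1 : q ≤ 1) (e : ι) {f g : (ι → Bool) → ℝ}
    (h : ∀ x, f x ≤ g x) (x : ι → Bool) : resample q e f x ≤ resample q e g x := by
  have : 0 ≤ 1 - q := by linarith
  unfold resample
  gcongr <;> apply h

lemma sweep_mono {q : ℝ} (hq0 : 0 ≤ q) (hq1 : q ≤ 1) (l : List ι) {f g : (ι → Bool) → ℝ}
    (h : ∀ x, f x ≤ g x) (x : ι → Bool) : sweep q l f x ≤ sweep q l g x := by
  induction l generalizing x with
  | nil => exact h x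
  | cons e l ih => exact resample_mono hq0 hq1 e ih x

lemma sweep_sum {κ : Type*} (q : ℝ) (l : List ι) (s : Finset κ) (a : κ → ℝ)
    (f : κ → (ι → Bool) → ℝ) :
    sweep q l (fun x => ∑ k ∈ s, a k * f k x) = fun x => ∑ k ∈ s, a k * sweep q l (f k) x := by
  induction l with
  | nil => rfl
  | cons e l ih =>
    rw [sweep_cons, ih]
    funext x
    simp only [resample, sweep_cons, Finset.mul_sum, ← Finset.sum_add_distrib]
    exact Finset.sum_congr rfl fun k _ => by ring

lemma sweep_const (q : ℝ) (l : List ι) (c : ℝ) : sweep q l (fun _ => c) = fun _ => c := by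
  induction l with
  | nil => rfl
  | cons e l ih => rw [sweep_cons, ih]; funext x; simp only [resample]; ring

lemma diffAt_resample_self (q : ℝ) (e : ι) (f : (ι → Bool) → ℝ) (x : ι → Bool) :
    diffAt e (resample q e f) x = 0 := by
  simp [diffAt, resample]

lemma diffAt_resample (q : ℝ) {e e' : ι} (h : e ≠ e') (f : (ι → Bool) → ℝ) (x : ι → Bool) :
    diffAt e (resample q e' f) x = resample q e' (diffAt e f) x := by
  simp only [diffAt, resample, Function.update_comm h]
  ring

lemma diffAt_sweep_nonneg {q : ℝ} (hq0 : 0 ≤ q) (hq1 : q ≤ 1) (l : List ι) (e : ι) (σ : ℝ)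
    {f : (ι → Bool) → ℝ} (hf : ∀ x, 0 ≤ σ * diffAt e f x) (x : ι → Bool) :
    0 ≤ σ * diffAt e (sweep q l f) x := by
  induction l generalizing x with
  | nil => exact hf x
  | cons e' l ih =>
    rw [sweep_cons]
    rcases eq_or_ne e e' with rfl | h
    · simp [diffAt_resample_self]
    · have h1 : 0 ≤ 1 - q := by linarith
      rw [diffAt_resample q h, resample, mul_add, mul_left_comm, mul_left_comm σ]
      exact add_nonneg (mul_nonneg hq0 (ih _)) (mul_nonneg h1 (ih _))

lemma abs_diffAt_sweep_le {q : ℝ} (hq0 : 0 ≤ q) (hq1 : q ≤ 1) (l : List ι) (e : ι) {c : ℝ}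
    {f : (ι → Bool) → ℝ} (hf : ∀ x, |diffAt e f x| ≤ c) (x : ι → Bool) :
    |diffAt e (sweep q l f) x| ≤ c := by
  induction l generalizing x with
  | nil => exact hf x
  | cons e' l ih =>
    rw [sweep_cons]
    rcases eq_or_ne e e' with rfl | h
    · rw [diffAt_resample_self, abs_zero]
      exact (abs_nonneg _).trans (hf x)
    · rw [diffAt_resample q h, resample]
      have h1 := abs_le.1 (ih (Function.update x e' true))
      have h2 := abs_le.1 (ih (Function.update x e' false))
      rw [abs_le]
      constructor <;> nlinarith

lemma two_point_exp_le {q : ℝ} (hq0 : 0 ≤ q) (hq1 : q ≤ 1) (u v c : ℝ) (hc : |u - v| ≤ c)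
    (hc1 : c ≤ 1) :
    q * Real.exp u + (1 - q) * Real.exp v ≤ Real.exp (q * u + (1 - q) * v + c ^ 2) := by
  have hd : |u - v| ≤ 1 := hc.trans hc1
  have hd2 : (u - v) ^ 2 ≤ c ^ 2 := sq_le_sq' (by linarith [neg_abs_le (u - v)])
    ((le_abs_self _).trans hc)
  set m := q * u + (1 - q) * v
  have hexp : ∀ y : ℝ, |y| ≤ 1 → Real.exp y ≤ 1 + y + y ^ 2 := fun y hy => by
    linarith [(abs_le.1 (Real.abs_exp_sub_one_sub_id_le hy)).2]
  have e1 : u - m = (1 - q) * (u - v) := by simp only [m]; ring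
  have e2 : v - m = -(q * (u - v)) := by simp only [m]; ring
  have b1 : Real.exp (u - m) ≤ 1 + (u - m) + (u - m) ^ 2 := by
    apply hexp
    rw [e1, abs_mul, abs_of_nonneg (by linarith)]
    nlinarith [abs_nonneg (u - v)]
  have b2 : Real.exp (v - m) ≤ 1 + (v - m) + (v - m) ^ 2 := by
    apply hexp
    rw [e2, abs_neg, abs_mul, abs_of_nonneg hq0]
    nlinarith [abs_nonneg (u - v)]
  have key : q * Real.exp (u - m) + (1 - q) * Real.exp (v - m) ≤ Real.exp (c ^ 2) := by
    have h1q : 0 ≤ 1 - q := by linarith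
    calc q * Real.exp (u - m) + (1 - q) * Real.exp (v - m)
        ≤ q * (1 + (u - m) + (u - m) ^ 2) + (1 - q) * (1 + (v - m) + (v - m) ^ 2) := by gcongr
      _ = q * (1 - q) * (u - v) ^ 2 + 1 := by rw [e1, e2]; ring
      _ ≤ c ^ 2 + 1 := by nlinarith [sq_nonneg (u - v), mul_nonneg hq0 h1q, sq_nonneg q]
      _ ≤ Real.exp (c ^ 2) := Real.add_one_le_exp _
  calc q * Real.exp u + (1 - q) * Real.exp v
      = Real.exp m * (q * Real.exp (u - m) + (1 - q) * Real.exp (v - m)) := by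
        rw [mul_add, mul_left_comm, ← Real.exp_add, mul_left_comm _ (1 - q), ← Real.exp_add]
        congr 3 <;> ring_nf
    _ ≤ Real.exp m * Real.exp (c ^ 2) := by gcongr
    _ = _ := by rw [← Real.exp_add]

/-- A bounded differences inequality for the exponential moment under resampling. -/
lemma sweep_exp_le {q : ℝ} (hq0 : 0 ≤ q) (hq1 : q ≤ 1) (l : List ι) {c : ι → ℝ}
    {f : (ι → Bool) → ℝ} (hf : ∀ e x, |diffAt e f x| ≤ c e) (hc : ∀ e, c e ≤ 1)
    (x : ι → Bool) :
    sweep q l (fun y => Real.exp (f y)) x ≤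
      Real.exp (sweep q l f x + (l.map fun e => c e ^ 2).sum) := by
  induction l generalizing x with
  | nil => simp
  | cons e l ih =>
    rw [sweep_cons, sweep_cons]
    refine (resample_mono hq0 hq1 e ih x).trans ?_
    have h := two_point_exp_le hq0 hq1
      (sweep q l f (Function.update x e true)) (sweep q l f (Function.update x e false)) (c e)
      (abs_diffAt_sweep_le hq0 hq1 l e (hf e) x) (hc e)
    simp only [resample, Real.exp_add, List.map_cons, List.sum_cons] at h ⊢
    nlinarith [mul_le_mul_of_nonneg_right h
      (Real.exp_pos ((l.map fun e => c e ^ 2).sum)).le]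

/-- The indicator that all the coordinates in `S` are `true`. -/
def allTrue (S : Finset ι) (x : ι → Bool) : ℝ := if ∀ e ∈ S, x e = true then 1 else 0

lemma allTrue_nonneg {α : Type*} (S : Finset α) (x : α → Bool) : 0 ≤ allTrue S x := by
  unfold allTrue; split_ifs <;> norm_num

lemma allTrue_le_one {α : Type*} (S : Finset α) (x : α → Bool) : allTrue S x ≤ 1 := by
  unfold allTrue; split_ifs <;> norm_num

lemma allTrue_update_true (S : Finset ι) (e : ι) (x : ι → Bool) :
    allTrue S (Function.update x e true) = allTrue (S.erase e) x := by
  unfold allTrue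
  congr 1
  refine propext ⟨fun h f hf => ?_, fun h f hf => ?_⟩
  · simpa [Finset.ne_of_mem_erase hf] using h f (Finset.mem_of_mem_erase hf)
  · rcases eq_or_ne f e with rfl | hfe
    · simp
    · simpa [hfe] using h f (Finset.mem_erase.2 ⟨hfe, hf⟩)

lemma allTrue_update_false (S : Finset ι) (e : ι) (x : ι → Bool) :
    allTrue S (Function.update x e false) = if e ∈ S then 0 else allTrue (S.erase e) x := by
  split_ifs with h
  · exact if_neg fun h' => by simpa using h' e h
  · rw [Finset.erase_eq_of_notMem h]
    unfold allTrue
    congr 1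
    refine propext (forall₂_congr fun f hf => ?_)
    rw [Function.update_of_ne (ne_of_mem_of_not_mem hf h)]

lemma diffAt_allTrue (S : Finset ι) (e : ι) (x : ι → Bool) :
    diffAt e (allTrue S) x = if e ∈ S then allTrue (S.erase e) x else 0 := by
  rw [diffAt, allTrue_update_true, allTrue_update_false]
  split_ifs <;> simp

lemma sweep_allTrue (q : ℝ) (l : List ι) (hl : l.Nodup) (S : Finset ι) (x : ι → Bool) :
    sweep q l (allTrue S) x = q ^ (S ∩ l.toFinset).card * allTrue (S \ l.toFinset) x := by
  induction l generalizing x with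
  | nil => simp
  | cons e l ih =>
    obtain ⟨hel, hl⟩ := List.nodup_cons.1 hl
    have hel' : e ∉ l.toFinset := by simpa using hel
    have hsd : S \ (e :: l).toFinset = (S \ l.toFinset).erase e := by
      ext; simp; tauto
    simp only [sweep_cons, resample, ih hl, allTrue_update_true, allTrue_update_false, hsd]
    by_cases he : e ∈ S
    · have : S ∩ (e :: l).toFinset = insert e (S ∩ l.toFinset) := by
        rw [List.toFinset_cons, Finset.inter_insert_of_mem he]
      rw [this, Finset.card_insert_of_notMem (by simp [hel]), if_pos (by simp [he, hel]), pow_succ]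
      ring
    · have : S ∩ (e :: l).toFinset = S ∩ l.toFinset := by
        rw [List.toFinset_cons, Finset.inter_insert_of_notMem he]
      rw [this, if_neg (by simp [he])]
      ring

lemma sweep_univ_allTrue [Fintype ι] (q : ℝ) (S : Finset ι) (x : ι → Bool) :
    sweep q (Finset.univ : Finset ι).toList (allTrue S) x = q ^ S.card := by
  rw [sweep_allTrue q _ (Finset.nodup_toList _)]
  simp [allTrue]

lemma sum_eq_sum_of_update [Fintype ι] (e : ι) {F F' : (ι → Bool) → ℝ}
    (h : ∀ x, F (Function.update x e true) + F (Function.update x e false) =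
      F' (Function.update x e true) + F' (Function.update x e false)) :
    ∑ x, F x = ∑ x, F' x := by
  have hinv : Function.Involutive fun x : ι → Bool => Function.update x e (!x e) := fun x => by
    simp
  have hpair : ∀ (A : (ι → Bool) → ℝ) (x : ι → Bool),
      A x + A (Function.update x e (!x e)) =
        A (Function.update x e true) + A (Function.update x e false) := by
    intro A x
    rcases hx : x e with _ | _
    · have : Function.update x e false = x := by rw [← hx, Function.update_eq_self]
      rw [this, add_comm]; rfl
    · have : Function.update x e true = x := by rw [← hx, Function.update_eq_self]
      rw [this]; rfl
  have hdouble : ∀ A : (ι → Bool) → ℝ, 2 * ∑ x, A x =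
      ∑ x, (A (Function.update x e true) + A (Function.update x e false)) := by
    intro A
    have hflip : ∑ x : ι → Bool, A (Function.update x e (!x e)) = ∑ x, A x :=
      Equiv.sum_comp hinv.toPerm A
    rw [← Finset.sum_congr rfl fun x _ => hpair A x, Finset.sum_add_distrib, hflip, two_mul]
  have := hdouble F
  rw [Finset.sum_congr rfl fun x _ => h x, ← hdouble F'] at this
  linarith

end Resampling

section Gibbs

variable {ι : Type*} [DecidableEq ι] [Fintype ι]

lemma Phi_eq_sigmoid (u : ℝ) : Phi u = Real.sigmoid u := by
  rw [Phi, Real.sigmoid_def, Real.exp_neg]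
  have := Real.exp_pos u
  field_simp
  ring

lemma Phi_nonneg (u : ℝ) : 0 ≤ Phi u := by
  rw [Phi_eq_sigmoid]; exact Real.sigmoid_nonneg u

lemma Phi_le_one (u : ℝ) : Phi u ≤ 1 := by
  rw [Phi_eq_sigmoid]; exact Real.sigmoid_le_one u

lemma Phi_mono : Monotone Phi := by
  intro u v h
  rw [Phi_eq_sigmoid, Phi_eq_sigmoid]
  exact Real.sigmoid_le h

/-- The Gibbs weight of a configuration for the Hamiltonian `H`. -/
noncomputable def gibbs (H : (ι → Bool) → ℝ) (x : ι → Bool) : ℝ :=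
  Real.exp (H x) / ∑ y, Real.exp (H y)

lemma gibbs_nonneg (H : (ι → Bool) → ℝ) (x : ι → Bool) : 0 ≤ gibbs H x := by
  unfold gibbs; positivity

lemma sum_gibbs (H : (ι → Bool) → ℝ) : ∑ x, gibbs H x = 1 := by
  unfold gibbs
  rw [← Finset.sum_div]
  exact div_self (Finset.sum_pos (fun _ _ => Real.exp_pos _) Finset.univ_nonempty).ne'

/-- Invariance of the Gibbs weight under resampling a coordinate from its conditional law. -/
lemma sum_gibbs_resample (H : (ι → Bool) → ℝ) (e : ι) (f : (ι → Bool) → ℝ) :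
    ∑ x, gibbs H x * f x = ∑ x, gibbs H x * resample (Phi (diffAt e H x)) e f x := by
  refine sum_eq_sum_of_update e fun x => ?_
  simp only [resample, diffAt, Function.update_idem, gibbs, Phi, Real.exp_sub]
  have h1 := Real.exp_pos (H (Function.update x e true))
  have h2 := Real.exp_pos (H (Function.update x e false))
  have h3 : 0 < ∑ y, Real.exp (H y) :=
    Finset.sum_pos (fun _ _ => Real.exp_pos _) Finset.univ_nonempty
  field_simp
  ring

/-- The indicator that `g` exceeds `b` (for `σ = 1`) or falls short of `b` (for `σ = -1`). -/
noncomputable def beyond (σ b : ℝ) (g : (ι → Bool) → ℝ) (x : ι → Bool) : ℝ :=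
  if 0 < σ * (g x - b) then 1 else 0

lemma beyond_nonneg {α : Type*} (σ b : ℝ) (g : (α → Bool) → ℝ) (x : α → Bool) :
    0 ≤ beyond σ b g x := by
  unfold beyond; split_ifs <;> norm_num

lemma beyond_le_one {α : Type*} (σ b : ℝ) (g : (α → Bool) → ℝ) (x : α → Bool) :
    beyond σ b g x ≤ 1 := by
  unfold beyond; split_ifs <;> norm_num

lemma diffAt_beyond_nonneg {α : Type*} [DecidableEq α] {σ : ℝ} (hσ : σ = 1 ∨ σ = -1) (b : ℝ)
    {g : (α → Bool) → ℝ} {e : α}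
    (hg : ∀ x, 0 ≤ diffAt e g x) (x : α → Bool) : 0 ≤ σ * diffAt e (beyond σ b g) x := by
  have := hg x
  unfold diffAt at this ⊢
  unfold beyond
  rcases hσ with rfl | rfl <;> split_ifs <;> norm_num <;> linarith

lemma beyond_le_exp {α : Type*} (σ b : ℝ) {t : ℝ} (ht : 0 ≤ t)
    (g : (α → Bool) → ℝ) (x : α → Bool) :
    beyond σ b g x ≤ Real.exp (t * (σ * (g x - b))) := by
  unfold beyond
  split_ifs with h
  · exact Real.one_le_exp (by positivity)
  · exact (Real.exp_pos _).le

/-- If each conditional probability rarely goes beyond `Phi b`, then the Gibbs measure is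
stochastically dominated, up to a small error, by the Bernoulli product measure. -/
lemma sum_gibbs_le_sweep (H : (ι → Bool) → ℝ) {σ b δ : ℝ} (hσ : σ = 1 ∨ σ = -1)
    (hδ : ∀ e, ∑ x, gibbs H x * beyond σ b (diffAt e H) x ≤ δ) (l : List ι)
    {f : (ι → Bool) → ℝ} (hf0 : ∀ x, 0 ≤ f x) (hf1 : ∀ x, f x ≤ 1)
    (hf : ∀ e x, 0 ≤ σ * diffAt e f x) :
    ∑ x, gibbs H x * f x ≤ ∑ x, gibbs H x * sweep (Phi b) l f x + l.length * δ := by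
  induction l with
  | nil => simp
  | cons e l ih =>
    have hq0 := Phi_nonneg b
    have hq1 := Phi_le_one b
    set F := sweep (Phi b) l f with hF
    have hF0 : ∀ x, 0 ≤ F x := fun x => by
      simpa [sweep_const] using sweep_mono hq0 hq1 l (f := fun _ => 0) hf0 x
    have hF1 : ∀ x, F x ≤ 1 := fun x => by
      simpa [sweep_const] using sweep_mono hq0 hq1 l (g := fun _ => 1) hf1 x
    have hFd : ∀ x, 0 ≤ σ * diffAt e F x := diffAt_sweep_nonneg hq0 hq1 l e σ (hf e)
    have hstep : ∀ x, resample (Phi (diffAt e H x)) e F x ≤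
        resample (Phi b) e F x + beyond σ b (diffAt e H) x := by
      intro x
      have hd := hFd x
      have u0 := hF0 (Function.update x e true)
      have u1 := hF1 (Function.update x e true)
      have v0 := hF0 (Function.update x e false)
      have v1 := hF1 (Function.update x e false)
      have p0 := Phi_nonneg (diffAt e H x)
      have p1 := Phi_le_one (diffAt e H x)
      have hid : resample (Phi (diffAt e H x)) e F x = resample (Phi b) e F x +
          (Phi (diffAt e H x) - Phi b) * diffAt e F x := by
        simp only [resample, diffAt]; ring
      rw [hid, add_le_add_iff_left]
      unfold beyond
      split_ifs with h
      · have h1 : |Phi (diffAt e H x) - Phi b| ≤ 1 := abs_le.2 ⟨by linarith, by linarith⟩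
        have h2 : |diffAt e F x| ≤ 1 := by
          unfold diffAt; exact abs_le.2 ⟨by linarith, by linarith⟩
        refine (le_abs_self _).trans ?_
        rw [abs_mul]
        exact mul_le_one₀ h1 (abs_nonneg _) h2
      · rcases hσ with rfl | rfl
        · have := Phi_mono (show diffAt e H x ≤ b by linarith)
          exact mul_nonpos_of_nonpos_of_nonneg (by linarith) (by linarith)
        · have := Phi_mono (show b ≤ diffAt e H x by linarith)
          exact mul_nonpos_of_nonneg_of_nonpos (by linarith) (by linarith)
    have hsum : ∑ x, gibbs H x * F x ≤
        ∑ x, gibbs H x * sweep (Phi b) (e :: l) f x + δ := by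
      rw [sum_gibbs_resample H e F]
      calc ∑ x, gibbs H x * resample (Phi (diffAt e H x)) e F x
          ≤ ∑ x, gibbs H x * (resample (Phi b) e F x + beyond σ b (diffAt e H) x) :=
            Finset.sum_le_sum fun x _ => mul_le_mul_of_nonneg_left (hstep x) (gibbs_nonneg H x)
        _ = ∑ x, gibbs H x * resample (Phi b) e F x +
              ∑ x, gibbs H x * beyond σ b (diffAt e H) x := by
            simp only [mul_add, Finset.sum_add_distrib]
        _ ≤ _ := by rw [sweep_cons]; gcongr; exact hδ e
    rw [List.length_cons]
    push_cast
    linarith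

/-- One step of the concentration bootstrap: a tail bound at level `b` for all the discrete
derivatives of the Hamiltonian yields a tail bound at level `b'`. -/
lemma sum_gibbs_beyond_le (H : (ι → Bool) → ℝ) {σ b b' δ t K η m : ℝ} (hσ : σ = 1 ∨ σ = -1)
    (hδ : ∀ e, ∑ x, gibbs H x * beyond σ b (diffAt e H) x ≤ δ) (e : ι) {c : ι → ℝ}
    (hmono : ∀ e' x, 0 ≤ diffAt e' (diffAt e H) x) (hc : ∀ e' x, diffAt e' (diffAt e H) x ≤ c e')
    (ht : 0 ≤ t) (htc : ∀ e', t * c e' ≤ 1) (hK : ∑ e', c e' ^ 2 ≤ K)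
    (hm : ∀ x, sweep (Phi b) Finset.univ.toList (diffAt e H) x = m) (hη : σ * (m - b') ≤ -η) :
    ∑ x, gibbs H x * beyond σ b' (diffAt e H) x ≤
      Real.exp (-(t * η) + t ^ 2 * K) + Fintype.card ι * δ := by
  have hq0 := Phi_nonneg b
  have hq1 := Phi_le_one b
  have hσ2 : |σ| = 1 := by rcases hσ with rfl | rfl <;> norm_num
  have h := sum_gibbs_le_sweep H hσ hδ Finset.univ.toList (beyond_nonneg σ b' (diffAt e H))
    (beyond_le_one σ b' (diffAt e H)) (fun e' => diffAt_beyond_nonneg hσ b' (hmono e'))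
  rw [Finset.length_toList, Finset.card_univ] at h
  refine h.trans (add_le_add_left ?_ _)
  have hpt : ∀ x, sweep (Phi b) Finset.univ.toList (beyond σ b' (diffAt e H)) x ≤
      Real.exp (-(t * η) + t ^ 2 * K) := by
    intro x
    refine (sweep_mono hq0 hq1 _ (beyond_le_exp σ b' ht (diffAt e H)) x).trans ?_
    refine (sweep_exp_le hq0 hq1 _ (c := fun e' => t * c e') (fun e' y => ?_) htc x).trans ?_
    · have : diffAt e' (fun y => t * (σ * (diffAt e H y - b'))) y =
          t * (σ * diffAt e' (diffAt e H) y) := by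
        simp only [diffAt]; ring
      rw [this, abs_mul, abs_mul, hσ2, one_mul, abs_of_nonneg ht, abs_of_nonneg (hmono e' y)]
      exact mul_le_mul_of_nonneg_left (hc e' y) ht
    · have hlin := congrFun (sweep_sum (Phi b) (Finset.univ : Finset ι).toList
        (Finset.univ : Finset Bool) (fun i => if i then t * σ else -(t * σ * b'))
        (fun i y => if i then diffAt e H y else 1)) x
      simp only [Fintype.sum_bool, if_true, Bool.false_eq_true, if_false, sweep_const, hm] at hlin
      have hfun : (fun y => t * (σ * (diffAt e H y - b'))) =
          fun y => t * σ * diffAt e H y + -(t * σ * b') * 1 := by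
        funext y; ring
      rw [hfun, hlin, Finset.sum_map_toList, Real.exp_le_exp]
      simp only [mul_pow, ← Finset.mul_sum]
      have h1 := mul_le_mul_of_nonneg_left hK (sq_nonneg t)
      have h2 := mul_le_mul_of_nonneg_left hη ht
      linarith
  calc ∑ x, gibbs H x * sweep (Phi b) Finset.univ.toList (beyond σ b' (diffAt e H)) x
      ≤ ∑ x, gibbs H x * Real.exp (-(t * η) + t ^ 2 * K) :=
        Finset.sum_le_sum fun x _ => mul_le_mul_of_nonneg_left (hpt x) (gibbs_nonneg H x)
    _ = _ := by rw [← Finset.sum_mul, sum_gibbs, one_mul]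

end Gibbs

section Counting

open scoped Classical in
/-- The set of edges of `K_n` covered by the copy of `G` placed by `ψ`. -/
noncomputable def edgeImage {n m : ℕ} (G : SimpleGraph (Fin m)) (ψ : Fin m ↪ Fin n) :
    Finset (EdgeSet n) :=
  Finset.univ.filter fun e => ∃ a b, G.Adj a b ∧ s(ψ a, ψ b) = e.1

lemma mem_edgeImage {n m : ℕ} {G : SimpleGraph (Fin m)} {ψ : Fin m ↪ Fin n} {e : EdgeSet n} :
    e ∈ edgeImage G ψ ↔ ∃ a b, G.Adj a b ∧ s(ψ a, ψ b) = e.1 := by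
  simp [edgeImage]

lemma card_edgeImage {n m : ℕ} (G : SimpleGraph (Fin m)) (ψ : Fin m ↪ Fin n) :
    (edgeImage G ψ).card = numEdges G := by
  have himg : ((edgeImage G ψ).map (Function.Embedding.subtype _) : Set (Sym2 (Fin n))) =
      Sym2.map ψ '' G.edgeSet := by
    ext z
    simp only [Finset.coe_map, Function.Embedding.subtype_apply, Set.mem_image, Finset.mem_coe,
      mem_edgeImage]
    constructor
    · rintro ⟨e, ⟨a, b, hab, h⟩, rfl⟩
      exact ⟨s(a, b), hab, by simpa using h⟩
    · rintro ⟨w, hw, rfl⟩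
      induction w with
      | _ a b =>
        have hab : G.Adj a b := hw
        exact ⟨⟨s(ψ a, ψ b), by simpa using hab.ne⟩, ⟨a, b, hab, rfl⟩, rfl⟩
  rw [numEdges, ← Set.ncard_image_of_injective _ (Sym2.map.injective ψ.injective), ← himg,
    Set.ncard_coe_finset, Finset.card_map]

open scoped Classical in
lemma prod_edgeInd {n m : ℕ} (G : SimpleGraph (Fin m)) (ψ : Fin m ↪ Fin n) (x : Config n) :
    (∏ a : Fin m, ∏ b : Fin m, if G.Adj a b then edgeInd x (ψ a) (ψ b) else 1) =
      allTrue (edgeImage G ψ) x := by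
  have hval : ∀ a b (h : G.Adj a b), edgeVal x (ψ a) (ψ b) =
      x ⟨s(ψ a, ψ b), by simpa using h.ne⟩ := fun a b h => by
    rw [edgeVal, dif_neg]
  unfold allTrue
  split_ifs with h
  · refine Finset.prod_eq_one fun a _ => Finset.prod_eq_one fun b _ => ?_
    split_ifs with hab
    · rw [edgeInd, if_pos]
      rw [hval a b hab]
      exact h _ (mem_edgeImage.2 ⟨a, b, hab, rfl⟩)
    · rfl
  · push Not at h
    obtain ⟨e, he, hx⟩ := h
    obtain ⟨a, b, hab, hs⟩ := mem_edgeImage.1 he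
    refine Finset.prod_eq_zero (Finset.mem_univ a) (Finset.prod_eq_zero (Finset.mem_univ b) ?_)
    rw [if_pos hab, edgeInd, if_neg]
    rw [hval a b hab]
    convert hx

lemma NG_eq_sum_allTrue {n m : ℕ} (G : SimpleGraph (Fin m)) (x : Config n) :
    NG G x = ∑ ψ : Fin m ↪ Fin n, allTrue (edgeImage G ψ) x :=
  Finset.sum_congr rfl fun ψ _ => prod_edgeInd G ψ x

/-- The number of placements of `G` in `K_n` covering the edge `e`. -/
noncomputable def copies {n m : ℕ} (G : SimpleGraph (Fin m)) (e : EdgeSet n) : ℝ :=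
  ∑ ψ : Fin m ↪ Fin n, if e ∈ edgeImage G ψ then 1 else 0

lemma exists_perm_map_eq {n : ℕ} (e e' : EdgeSet n) :
    ∃ τ : Equiv.Perm (Fin n), Sym2.map τ e.1 = e'.1 := by
  obtain ⟨⟨a, b⟩, hab⟩ := e
  obtain ⟨⟨c, d⟩, hcd⟩ := e'
  have hab' : a ≠ b := by simpa using hab
  have hcd' : c ≠ d := by simpa using hcd
  refine ⟨(Equiv.swap a c).trans (Equiv.swap (Equiv.swap a c b) d), ?_⟩
  have h1 : c ≠ Equiv.swap a c b := by
    intro h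
    apply hab'
    apply (Equiv.swap a c).injective
    rw [← h, Equiv.swap_apply_left]
  have h2 : Equiv.swap (Equiv.swap a c b) d c = c := Equiv.swap_apply_of_ne_of_ne h1 hcd'
  change Sym2.map _ s(a, b) = s(c, d)
  simp [h2]

lemma copies_eq {n m : ℕ} (G : SimpleGraph (Fin m)) (e e' : EdgeSet n) :
    copies G e = copies G e' := by
  obtain ⟨τ, hτ⟩ := exists_perm_map_eq e e'
  have hcongr := Equiv.sum_comp (Equiv.embeddingCongr (Equiv.refl (Fin m)) τ)
    (fun ψ : Fin m ↪ Fin n => if e' ∈ edgeImage G ψ then (1 : ℝ) else 0)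
  rw [copies, copies, ← hcongr]
  refine Finset.sum_congr rfl fun ψ _ => ?_
  congr 1
  simp only [mem_edgeImage, ← hτ, eq_iff_iff]
  refine exists₂_congr fun a b => and_congr_right fun _ => ?_
  rw [← (Sym2.map.injective τ.injective).eq_iff]
  simp

lemma copies_mul {n m : ℕ} (G : SimpleGraph (Fin m)) (e : EdgeSet n) :
    copies G e * (n * (n - 1)) = 2 * numEdges G * n.descFactorial m := by
  have hsum : ∑ e' : EdgeSet n, copies G e' = numEdges G * n.descFactorial m := by
    simp only [copies]
    rw [Finset.sum_comm]
    simp [card_edgeImage, mul_comm]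
  rw [Finset.sum_congr rfl fun e' _ => copies_eq G e' e, Finset.sum_const, Finset.card_univ,
    Sym2.card_subtype_not_diag, Fintype.card_fin, nsmul_eq_mul, Nat.cast_choose_two] at hsum
  linarith

lemma numEdges_eq_zero {m : ℕ} (hm : m < 2) (G : SimpleGraph (Fin m)) : numEdges G = 0 := by
  have : Subsingleton (Fin m) := Fin.subsingleton_iff_le_one.2 (by omega)
  rw [numEdges, Subsingleton.elim G ⊥]
  simp

lemma pow_mul_le_mul_descFactorial (n k : ℕ) :
    (n : ℝ) ^ k * (n - k ^ 2) ≤ n * n.descFactorial k := by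
  induction k with
  | zero => simp
  | succ k ih =>
    rw [Nat.descFactorial_succ]
    have hn : (0 : ℝ) ≤ n := Nat.cast_nonneg n
    have hk : (0 : ℝ) ≤ k := Nat.cast_nonneg k
    rcases le_or_gt k n with h | h
    · push_cast [Nat.cast_sub h]
      have hnk : (0 : ℝ) ≤ n - k := sub_nonneg.2 (by exact_mod_cast h)
      calc (n : ℝ) ^ (k + 1) * (n - (k + 1) ^ 2)
          = (n : ℝ) ^ k * ((n : ℝ) ^ 2 - ((k : ℝ) + 1) ^ 2 * n) := by ring
        _ ≤ (n : ℝ) ^ k * (((n : ℝ) - k) * (n - (k : ℝ) ^ 2)) := by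
            refine mul_le_mul_of_nonneg_left ?_ (by positivity)
            nlinarith [mul_nonneg hk hn, pow_nonneg hk 3]
        _ = ((n : ℝ) - k) * ((n : ℝ) ^ k * (n - (k : ℝ) ^ 2)) := by ring
        _ ≤ ((n : ℝ) - k) * (n * n.descFactorial k) := mul_le_mul_of_nonneg_left ih hnk
        _ = _ := by ring
    · have hlt : (n : ℝ) ≤ k := by exact_mod_cast h.le
      refine le_trans (mul_nonpos_of_nonneg_of_nonpos (by positivity) ?_) (by positivity)
      push_cast
      nlinarith

/-- Asymptotics of the number of placements of `G` covering a fixed edge. -/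
lemma abs_copies_div_sub_le {n m : ℕ} (hn : 2 ≤ n) (G : SimpleGraph (Fin m)) (e : EdgeSet n) :
    |copies G e / (n : ℝ) ^ (m - 2) - 2 * numEdges G| ≤
      2 * numEdges G * (2 * m ^ 2 + 2) / n := by
  have hn2 : (2 : ℝ) ≤ n := by exact_mod_cast hn
  have hn0 : (0 : ℝ) < n := by linarith
  have hn1 : (0 : ℝ) < n - 1 := by linarith
  have hmul := copies_mul G e
  rcases lt_or_ge m 2 with hm | hm
  · have h0 : copies G e = 0 := by
      simpa [numEdges_eq_zero hm G, hn0.ne', hn1.ne'] using hmul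
    simp [numEdges_eq_zero hm G, h0]
  have hlow := pow_mul_le_mul_descFactorial n m
  have hup : (n.descFactorial m : ℝ) ≤ n ^ m := by exact_mod_cast Nat.descFactorial_le_pow n m
  have hE : (0 : ℝ) ≤ numEdges G := Nat.cast_nonneg _
  have hpow : (n : ℝ) ^ m = n ^ (m - 2) * n ^ 2 := by rw [← pow_add]; congr 1; omega
  have hP : (0 : ℝ) < n ^ (m - 2) := by positivity
  set R := copies G e / (n : ℝ) ^ (m - 2) with hR
  have hR' : copies G e = R * n ^ (m - 2) := by rw [hR]; field_simp
  set D : ℝ := n.descFactorial m / n ^ m with hD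
  have hD' : (n.descFactorial m : ℝ) = D * (n ^ (m - 2) * n ^ 2) := by
    rw [hD, ← hpow]; field_simp
  have hD1 : D ≤ 1 := by rw [hD, div_le_one (by positivity)]; exact hup
  have hD2 : (n - m ^ 2 : ℝ) ≤ n * D := by
    have : (n : ℝ) ^ m * (n - m ^ 2) ≤ n ^ m * (n * D) := by
      calc _ ≤ _ := hlow
        _ = _ := by rw [hD]; field_simp
    exact le_of_mul_le_mul_left this (by positivity)
  have hRD : R * (n - 1) = 2 * numEdges G * (D * n) := by
    rw [hR', hD'] at hmul
    have h2 : (n : ℝ) ^ (m - 2) * n ≠ 0 := by positivity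
    apply mul_left_cancel₀ h2
    linear_combination hmul
  have hdiff : (R - 2 * numEdges G) * (n - 1) = 2 * numEdges G * (D * n - n + 1) := by
    linear_combination hRD
  rw [le_div_iff₀ hn0]
  conv_lhs => rw [← abs_of_pos hn0, ← abs_mul]
  have hm2 : (0 : ℝ) ≤ (m : ℝ) ^ 2 := by positivity
  have hfac : (R - 2 * numEdges G) * n =
      2 * numEdges G * ((D * n - n + 1) * (n / (n - 1))) := by
    rw [← mul_assoc, ← hdiff, mul_assoc, mul_div_cancel₀ _ hn1.ne']
  have hq1 : 1 ≤ (n : ℝ) / (n - 1) := by rw [le_div_iff₀ hn1]; linarith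
  have hq2 : (n : ℝ) / (n - 1) ≤ 2 := by rw [div_le_iff₀ hn1]; linarith
  have hDn : D * n ≤ n := by nlinarith
  rw [hfac, abs_mul, abs_of_nonneg (by positivity : (0 : ℝ) ≤ 2 * numEdges G)]
  refine mul_le_mul_of_nonneg_left ?_ (by positivity)
  rw [abs_mul, abs_of_nonneg (by linarith : 0 ≤ (n : ℝ) / (n - 1))]
  have habs : |D * n - n + 1| ≤ (m : ℝ) ^ 2 + 1 := abs_le.2 ⟨by linarith, by linarith⟩
  calc |D * n - n + 1| * (n / (n - 1)) ≤ ((m : ℝ) ^ 2 + 1) * 2 := by gcongr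
    _ = _ := by ring

open scoped Classical in
lemma card_filter_eq_on_le {n m : ℕ} (A : Finset (Fin m)) (u : Fin m → Fin n) :
    (Finset.univ.filter fun ψ : Fin m ↪ Fin n => ∀ a ∈ A, ψ a = u a).card ≤ n ^ (m - A.card) := by
  calc _ ≤ (Fintype.piFinset fun a => if a ∈ A then {u a} else Finset.univ).card := by
        refine Finset.card_le_card_of_injOn (fun ψ => ψ) ?_ (DFunLike.coe_injective.injOn)
        intro ψ hψ
        simp only [Finset.coe_filter, Finset.mem_univ, true_and, Set.mem_ofPred_eq] at hψ
        simp only [Finset.mem_coe, Fintype.mem_piFinset]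
        intro a
        split_ifs with h
        · simpa using hψ a h
        · simp
    _ = _ := by
        rw [Fintype.card_piFinset]
        have : ∀ a : Fin m, (if a ∈ A then {u a} else (Finset.univ : Finset (Fin n))).card =
            if a ∈ A then 1 else n := fun a => by split_ifs <;> simp
        simp only [this, Finset.prod_ite, Finset.prod_const_one, one_mul, Finset.prod_const]
        congr 1
        rw [Finset.filter_notMem_eq_sdiff, Finset.card_sdiff_of_subset (Finset.subset_univ A)]
        simp

lemma exists_three_vertices {n : ℕ} {e e' : EdgeSet n} (h : e ≠ e') :
    ∃ u v w : Fin n, e.1 = s(u, v) ∧ w ∈ e'.1 ∧ u ≠ v ∧ w ≠ u ∧ w ≠ v := by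
  obtain ⟨⟨a, b⟩, hab⟩ := e
  obtain ⟨⟨c, d⟩, hcd⟩ := e'
  have hab' : a ≠ b := by simpa using hab
  have hcd' : c ≠ d := by simpa using hcd
  have hne : s(a, b) ≠ s(c, d) := fun h' => h (Subtype.ext h')
  rw [Ne, Sym2.eq_iff] at hne
  by_cases hc : c = a ∨ c = b
  · refine ⟨a, b, d, rfl, Sym2.mem_mk_right c d, hab', ?_, ?_⟩ <;> rintro rfl <;> aesop
  · exact ⟨a, b, c, rfl, Sym2.mem_mk_left c d, hab', fun h => hc (.inl h), fun h => hc (.inr h)⟩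

lemma vertex_mem_range {n m : ℕ} {G : SimpleGraph (Fin m)} {ψ : Fin m ↪ Fin n} {e : EdgeSet n}
    (he : e ∈ edgeImage G ψ) {v : Fin n} (hv : v ∈ e.1) : ∃ a, ψ a = v := by
  obtain ⟨a, b, -, h⟩ := mem_edgeImage.1 he
  rw [← h, Sym2.mem_iff] at hv
  exact hv.elim (fun h => ⟨a, h.symm⟩) fun h => ⟨b, h.symm⟩

/-- The number of placements covering two given distinct edges is of lower order. -/
lemma sum_two_edges_div_le {n m : ℕ} (hn : 0 < n) (G : SimpleGraph (Fin m)) {e e' : EdgeSet n}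
    (h : e ≠ e') :
    (∑ ψ : Fin m ↪ Fin n, (if e ∈ edgeImage G ψ then (1 : ℝ) else 0) *
      if e' ∈ edgeImage G ψ then 1 else 0) / (n : ℝ) ^ (m - 2) ≤ m ^ 3 / n := by
  classical
  obtain ⟨u, v, w, he, hw, huv, hwu, hwv⟩ := exists_three_vertices h
  have hn0 : (0 : ℝ) < n := by exact_mod_cast hn
  set T : Finset (Fin m ↪ Fin n) :=
    Finset.univ.filter fun ψ => e ∈ edgeImage G ψ ∧ e' ∈ edgeImage G ψ with hT
  have hsum : (∑ ψ : Fin m ↪ Fin n, (if e ∈ edgeImage G ψ then (1 : ℝ) else 0) *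
      if e' ∈ edgeImage G ψ then 1 else 0) = T.card := by
    rw [hT, Finset.card_filter, Nat.cast_sum]
    refine Finset.sum_congr rfl fun ψ _ => ?_
    by_cases h1 : e ∈ edgeImage G ψ <;> by_cases h2 : e' ∈ edgeImage G ψ <;> simp [h1, h2]
  have hcover : T ⊆ (Finset.univ : Finset (Fin m × Fin m × Fin m)).biUnion fun t =>
      Finset.univ.filter fun ψ : Fin m ↪ Fin n => ψ t.1 = u ∧ ψ t.2.1 = v ∧ ψ t.2.2 = w := by
    intro ψ hψ
    obtain ⟨h1, h2⟩ := (Finset.mem_filter.1 hψ).2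
    obtain ⟨a, ha⟩ := vertex_mem_range h1 (v := u) (by rw [he]; exact Sym2.mem_mk_left u v)
    obtain ⟨b, hb⟩ := vertex_mem_range h1 (v := v) (by rw [he]; exact Sym2.mem_mk_right u v)
    obtain ⟨c, hc⟩ := vertex_mem_range h2 hw
    exact Finset.mem_biUnion.2 ⟨(a, b, c), Finset.mem_univ _, by simp [ha, hb, hc]⟩
  have hfib : ∀ t : Fin m × Fin m × Fin m, (Finset.univ.filter fun ψ : Fin m ↪ Fin n =>
      ψ t.1 = u ∧ ψ t.2.1 = v ∧ ψ t.2.2 = w).card ≤ n ^ (m - 3) := by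
    rintro ⟨a, b, c⟩
    by_cases hd : a ≠ b ∧ c ≠ a ∧ c ≠ b
    · obtain ⟨hab, hca, hcb⟩ := hd
      have hcard : ({a, b, c} : Finset (Fin m)).card = 3 := by
        rw [Finset.card_eq_three]
        exact ⟨a, b, c, hab, hca.symm, hcb.symm, rfl⟩
      have := card_filter_eq_on_le {a, b, c} fun i => if i = a then u else if i = b then v else w
      rw [hcard] at this
      refine le_trans (Finset.card_le_card fun ψ hψ => ?_) this
      obtain ⟨h1, h2, h3⟩ := (Finset.mem_filter.1 hψ).2
      refine Finset.mem_filter.2 ⟨Finset.mem_univ _, ?_⟩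
      simp only [Finset.mem_insert, Finset.mem_singleton, forall_eq_or_imp, forall_eq]
      simp [hab.symm, hca, hcb, h1, h2, h3]
    · refine le_of_eq_of_le (Finset.card_eq_zero.2 (Finset.filter_eq_empty_iff.2 ?_)) (Nat.zero_le _)
      rintro ψ - ⟨rfl, rfl, rfl⟩
      exact hd ⟨fun h => huv (by rw [h]), fun h => hwu (by rw [h]), fun h => hwv (by rw [h])⟩
  have hTcard : T.card ≤ m ^ 3 * n ^ (m - 3) := by
    refine (Finset.card_le_card hcover).trans (Finset.card_biUnion_le.trans ?_)
    refine (Finset.sum_le_sum fun t _ => hfib t).trans ?_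
    simp [pow_three]
  rw [hsum]
  rcases lt_or_ge m 3 with hm | hm
  · have : T.card = 0 := by
      rw [Finset.card_eq_zero, Finset.eq_empty_iff_forall_notMem]
      intro ψ hψ
      obtain ⟨t, -, ht⟩ := Finset.mem_biUnion.1 (hcover hψ)
      obtain ⟨h1, h2, h3⟩ := (Finset.mem_filter.1 ht).2
      have h12 : t.1 ≠ t.2.1 := fun h => huv (by rw [← h1, ← h2, h])
      have h13 : t.2.2 ≠ t.1 := fun h => hwu (by rw [← h3, ← h1, h])
      have h23 : t.2.2 ≠ t.2.1 := fun h => hwv (by rw [← h3, ← h2, h])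
      omega
    rw [this]
    simp only [Nat.cast_zero, zero_div]
    positivity
  · have hpow : (n : ℝ) ^ (m - 2) = n ^ (m - 3) * n := by rw [← pow_succ]; congr 1; omega
    rw [hpow, div_le_div_iff₀ (by positivity) hn0]
    have : (T.card : ℝ) ≤ m ^ 3 * n ^ (m - 3) := by exact_mod_cast hTcard
    calc (T.card : ℝ) * n ≤ m ^ 3 * n ^ (m - 3) * n := by gcongr
      _ = _ := by ring

end Counting

section DiscreteDerivative

variable {n s : ℕ} (V : Fin s → ℕ) (G : ∀ i, SimpleGraph (Fin (V i))) (β : Fin s → ℝ)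

lemma diffAt_hamiltonian (e : EdgeSet n) :
    diffAt e (Hamiltonian V G β) = fun x => ∑ i, β i / (n : ℝ) ^ (V i - 2) *
      ∑ ψ : Fin (V i) ↪ Fin n, (if e ∈ edgeImage (G i) ψ then 1 else 0) *
        allTrue ((edgeImage (G i) ψ).erase e) x := by
  funext x
  simp only [diffAt, Hamiltonian, NG_eq_sum_allTrue, ← Finset.sum_sub_distrib]
  refine Finset.sum_congr rfl fun i _ => ?_
  rw [← sub_div, ← mul_sub, ← Finset.sum_sub_distrib, mul_div_right_comm]
  congr 1
  refine Finset.sum_congr rfl fun ψ _ => ?_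
  have := diffAt_allTrue (edgeImage (G i) ψ) e x
  rw [diffAt] at this
  rw [this, ite_mul, one_mul, zero_mul]

lemma diffAt_diffAt_hamiltonian (e e' : EdgeSet n) (x : Config n) :
    diffAt e' (diffAt e (Hamiltonian V G β)) x = ∑ i, β i / (n : ℝ) ^ (V i - 2) *
      ∑ ψ : Fin (V i) ↪ Fin n, (if e ∈ edgeImage (G i) ψ then 1 else 0) *
        if e' ∈ (edgeImage (G i) ψ).erase e then
          allTrue (((edgeImage (G i) ψ).erase e).erase e') x else 0 := by
  rw [diffAt_hamiltonian]
  simp only [diffAt]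
  rw [← Finset.sum_sub_distrib]
  refine Finset.sum_congr rfl fun i _ => ?_
  rw [← mul_sub, ← Finset.sum_sub_distrib]
  congr 1
  refine Finset.sum_congr rfl fun ψ _ => ?_
  rw [← mul_sub]
  congr 1
  exact diffAt_allTrue _ e' x

/-- A bound for the influence of the edge `e'` on the discrete derivative at the edge `e`. -/
noncomputable def influence (e e' : EdgeSet n) : ℝ :=
  ∑ i, β i / (n : ℝ) ^ (V i - 2) * ∑ ψ : Fin (V i) ↪ Fin n,
    (if e ∈ edgeImage (G i) ψ then 1 else 0) * if e' ∈ (edgeImage (G i) ψ).erase e then 1 else 0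

variable {β}

lemma influence_nonneg (hβ : ∀ i, 0 < β i) (e e' : EdgeSet n) : 0 ≤ influence V G β e e' := by
  refine Finset.sum_nonneg fun i _ => ?_
  have := (hβ i).le
  refine mul_nonneg (by positivity) (Finset.sum_nonneg fun ψ _ => ?_)
  positivity

lemma diffAt_diffAt_hamiltonian_nonneg (hβ : ∀ i, 0 < β i) (e e' : EdgeSet n) (x : Config n) :
    0 ≤ diffAt e' (diffAt e (Hamiltonian V G β)) x := by
  rw [diffAt_diffAt_hamiltonian]
  refine Finset.sum_nonneg fun i _ => ?_
  have := (hβ i).le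
  refine mul_nonneg (by positivity) (Finset.sum_nonneg fun ψ _ => ?_)
  split_ifs <;> simp [allTrue_nonneg]

lemma diffAt_diffAt_hamiltonian_le (hβ : ∀ i, 0 < β i) (e e' : EdgeSet n) (x : Config n) :
    diffAt e' (diffAt e (Hamiltonian V G β)) x ≤ influence V G β e e' := by
  rw [diffAt_diffAt_hamiltonian]
  refine Finset.sum_le_sum fun i _ => ?_
  have := (hβ i).le
  refine mul_le_mul_of_nonneg_left (Finset.sum_le_sum fun ψ _ => ?_) (by positivity)
  split_ifs <;> simp [allTrue_le_one]

lemma influence_le (hβ : ∀ i, 0 < β i) (hn : 0 < n) (e e' : EdgeSet n) :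
    influence V G β e e' ≤ (∑ i, β i * (V i : ℝ) ^ 3) / n := by
  rw [influence, Finset.sum_div]
  refine Finset.sum_le_sum fun i _ => ?_
  have hb := (hβ i).le
  rcases eq_or_ne e e' with rfl | h
  · simp only [Finset.notMem_erase, if_false, mul_zero, Finset.sum_const_zero]
    positivity
  · simp only [Finset.mem_erase, ne_eq, h.symm, not_false_eq_true, true_and]
    rw [div_mul_eq_mul_div, mul_div_assoc, mul_div_assoc]
    exact mul_le_mul_of_nonneg_left (sum_two_edges_div_le hn (G i) h) hb

lemma copies_div_le (hn : 2 ≤ n) {m : ℕ} (G : SimpleGraph (Fin m)) (e : EdgeSet n) :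
    copies G e / (n : ℝ) ^ (m - 2) ≤ 2 * numEdges G * (2 * m ^ 2 + 3) := by
  have h := (abs_le.1 (abs_copies_div_sub_le hn G e)).2
  have h2 : 2 * numEdges G * (2 * (m : ℝ) ^ 2 + 2) / n ≤ 2 * numEdges G * (2 * m ^ 2 + 2) :=
    div_le_self (by positivity) (by exact_mod_cast (by omega : 1 ≤ n))
  linarith

lemma sum_influence_le (hβ : ∀ i, 0 < β i) (hn : 2 ≤ n) (e : EdgeSet n) :
    ∑ e', influence V G β e e' ≤
      ∑ i, β i * (2 * numEdges (G i) * (2 * (V i : ℝ) ^ 2 + 3)) * numEdges (G i) := by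
  simp only [influence]
  rw [Finset.sum_comm]
  refine Finset.sum_le_sum fun i _ => ?_
  have hb := (hβ i).le
  rw [← Finset.mul_sum, Finset.sum_comm]
  have h1 : ∑ ψ : Fin (V i) ↪ Fin n, ∑ e' : EdgeSet n,
      ((if e ∈ edgeImage (G i) ψ then (1 : ℝ) else 0) *
        if e' ∈ (edgeImage (G i) ψ).erase e then 1 else 0) ≤
      copies (G i) e * numEdges (G i) := by
    rw [copies, Finset.sum_mul]
    refine Finset.sum_le_sum fun ψ _ => ?_
    rw [← Finset.mul_sum]
    refine mul_le_mul_of_nonneg_left ?_ (by positivity)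
    rw [Finset.sum_boole, ← card_edgeImage (G i) ψ]
    rw [Finset.filter_univ_mem]
    exact_mod_cast Finset.card_erase_le
  calc _ ≤ β i / (n : ℝ) ^ (V i - 2) * (copies (G i) e * numEdges (G i)) :=
        mul_le_mul_of_nonneg_left h1 (by positivity)
    _ = β i * (copies (G i) e / (n : ℝ) ^ (V i - 2)) * numEdges (G i) := by ring
    _ ≤ _ := by gcongr; exact copies_div_le hn (G i) e

lemma diffAt_hamiltonian_nonneg (hβ : ∀ i, 0 < β i) (e : EdgeSet n) (x : Config n) :
    0 ≤ diffAt e (Hamiltonian V G β) x := by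
  rw [diffAt_hamiltonian]
  refine Finset.sum_nonneg fun i _ => ?_
  have := (hβ i).le
  refine mul_nonneg (by positivity) (Finset.sum_nonneg fun ψ _ => ?_)
  exact mul_nonneg (by positivity) (allTrue_nonneg _ _)

lemma diffAt_hamiltonian_le (hβ : ∀ i, 0 < β i) (hn : 2 ≤ n) (e : EdgeSet n) (x : Config n) :
    diffAt e (Hamiltonian V G β) x ≤
      ∑ i, β i * (2 * numEdges (G i) * (2 * (V i : ℝ) ^ 2 + 3)) := by
  rw [diffAt_hamiltonian]
  refine Finset.sum_le_sum fun i _ => ?_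
  have hb := (hβ i).le
  have h1 : ∑ ψ : Fin (V i) ↪ Fin n, (if e ∈ edgeImage (G i) ψ then 1 else 0) *
      allTrue ((edgeImage (G i) ψ).erase e) x ≤ copies (G i) e :=
    Finset.sum_le_sum fun ψ _ => mul_le_of_le_one_right (by positivity) (allTrue_le_one _ _)
  calc _ ≤ β i / (n : ℝ) ^ (V i - 2) * copies (G i) e :=
        mul_le_mul_of_nonneg_left h1 (by positivity)
    _ = β i * (copies (G i) e / (n : ℝ) ^ (V i - 2)) := by ring
    _ ≤ _ := by gcongr; exact copies_div_le hn (G i) e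

lemma sweep_diffAt_hamiltonian (q : ℝ) (e : EdgeSet n) (x : Config n) :
    sweep q Finset.univ.toList (diffAt e (Hamiltonian V G β)) x =
      ∑ i, β i * (copies (G i) e / (n : ℝ) ^ (V i - 2)) * q ^ (numEdges (G i) - 1) := by
  rw [diffAt_hamiltonian, sweep_sum]
  refine Finset.sum_congr rfl fun i _ => ?_
  rw [sweep_sum, copies, Finset.sum_div, Finset.mul_sum, Finset.mul_sum, Finset.sum_mul]
  refine Finset.sum_congr rfl fun ψ _ => ?_
  rw [sweep_univ_allTrue]
  split_ifs with h
  · rw [Finset.card_erase_of_mem h, card_edgeImage]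
    ring
  · ring

lemma abs_sum_copies_sub_Psi_le (hβ : ∀ i, 0 < β i) (hn : 2 ≤ n) {q : ℝ} (hq0 : 0 ≤ q)
    (hq1 : q ≤ 1) (e : EdgeSet n) :
    |∑ i, β i * (copies (G i) e / (n : ℝ) ^ (V i - 2)) * q ^ (numEdges (G i) - 1) - Psi V G β q| ≤
      (∑ i, β i * (2 * numEdges (G i) * (2 * (V i : ℝ) ^ 2 + 2))) / n := by
  rw [Psi, ← Finset.sum_sub_distrib, Finset.sum_div]
  refine (Finset.abs_sum_le_sum_abs _ _).trans (Finset.sum_le_sum fun i _ => ?_)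
  have hb := (hβ i).le
  have : β i * (copies (G i) e / (n : ℝ) ^ (V i - 2)) * q ^ (numEdges (G i) - 1) -
      2 * β i * numEdges (G i) * q ^ (numEdges (G i) - 1) =
      β i * (copies (G i) e / (n : ℝ) ^ (V i - 2) - 2 * numEdges (G i)) *
        q ^ (numEdges (G i) - 1) := by ring
  rw [this, abs_mul, abs_mul, abs_of_nonneg hb, abs_of_nonneg (pow_nonneg hq0 _), mul_div_assoc]
  refine (mul_le_of_le_one_right (by positivity) (pow_le_one₀ hq0 hq1)).trans ?_
  exact mul_le_mul_of_nonneg_left (abs_copies_div_sub_le hn (G i) e) hb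

end DiscreteDerivative

section FixedPoint

variable {s : ℕ} {V : Fin s → ℕ} {G : ∀ i, SimpleGraph (Fin (V i))} {β : Fin s → ℝ} {p : ℝ}

lemma differentiable_Psi : Differentiable ℝ (Psi V G β) := by
  unfold Psi
  fun_prop

lemma differentiable_Phi : Differentiable ℝ Phi := by
  have : Phi = Real.sigmoid := funext Phi_eq_sigmoid
  rw [this]
  exact differentiable_sigmoid

lemma Psi_nonneg (hβ : ∀ i, 0 < β i) {q : ℝ} (hq : 0 ≤ q) : 0 ≤ Psi V G β q :=
  Finset.sum_nonneg fun i _ => by have := hβ i; positivity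

lemma Psi_mono (hβ : ∀ i, 0 < β i) {q q' : ℝ} (hq : 0 ≤ q) (h : q ≤ q') :
    Psi V G β q ≤ Psi V G β q' :=
  Finset.sum_le_sum fun i _ => by have := hβ i; gcongr

lemma Psi_Phi_mono (hβ : ∀ i, 0 < β i) : Monotone fun b => Psi V G β (Phi b) :=
  fun _ _ h => Psi_mono hβ (Phi_nonneg _) (Phi_mono h)

lemma Psi_Phi_eq_self (hsub : Subcritical V G β p) {b : ℝ} (h : Psi V G β (Phi b) = b) :
    b = Psi V G β p := by
  have : Phi b = p := hsub.2.1 _ (by rw [phiFn, h])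
  rw [← h, this]

lemma Phi_Psi_fixedPoint (hsub : Subcritical V G β p) : Phi (Psi V G β p) = p := hsub.1

lemma Psi_Phi_sub_lt (hβ : ∀ i, 0 < β i) (hsub : Subcritical V G β p) {b : ℝ}
    (hb : Psi V G β p < b) : Psi V G β (Phi b) < b := by
  by_contra! h
  have hcont : Continuous fun b => Psi V G β (Phi b) - b :=
    (differentiable_Psi.continuous.comp differentiable_Phi.continuous).sub continuous_id
  have hle : b ≤ Psi V G β 1 := h.trans (Psi_mono hβ (Phi_nonneg _) (Phi_le_one _))
  obtain ⟨z, hz, hz0⟩ := intermediate_value_Icc' hle hcont.continuousOn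
    ⟨sub_nonpos.2 (Psi_mono hβ (Phi_nonneg _) (Phi_le_one _)), sub_nonneg.2 h⟩
  have := Psi_Phi_eq_self hsub (sub_eq_zero.1 hz0)
  linarith [hz.1]

lemma lt_Psi_Phi_sub (hβ : ∀ i, 0 < β i) (hsub : Subcritical V G β p) {b : ℝ}
    (hb : b < Psi V G β p) : b < Psi V G β (Phi b) := by
  by_contra! h
  have hcont : Continuous fun b => Psi V G β (Phi b) - b :=
    (differentiable_Psi.continuous.comp differentiable_Phi.continuous).sub continuous_id
  have hle : 0 ≤ b := (Psi_nonneg hβ (Phi_nonneg _)).trans h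
  obtain ⟨z, hz, hz0⟩ := intermediate_value_Icc' hle hcont.continuousOn
    ⟨sub_nonpos.2 h, sub_nonneg.2 (Psi_nonneg hβ (Phi_nonneg _))⟩
  have := Psi_Phi_eq_self hsub (sub_eq_zero.1 hz0)
  linarith [hz.2]

/-- On bounded sets the map `Psi ∘ Phi` contracts towards its fixed point. -/
lemma exists_contraction (hβ : ∀ i, 0 < β i) (hsub : Subcritical V G β p) {S : ℝ} (hS : 0 < S) :
    ∃ ρ : ℝ, 0 ≤ ρ ∧ ρ < 1 ∧ ∀ b, |b - Psi V G β p| ≤ S →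
      |Psi V G β (Phi b) - Psi V G β p| ≤ ρ * |b - Psi V G β p| := by
  set a := Psi V G β p with ha
  set g : ℝ → ℝ := fun b => Psi V G β (Phi b) with hg
  have hga : g a = a := by simp only [hg, ha, Phi_Psi_fixedPoint hsub]
  have hdiff : Differentiable ℝ g := differentiable_Psi.comp differentiable_Phi
  have hderiv : deriv g a < 1 := by
    have h1 : deriv g a = deriv (Psi V G β) p * deriv Phi a := by
      rw [← Phi_Psi_fixedPoint hsub]
      exact deriv_comp a (differentiable_Psi _) (differentiable_Phi _)
    have h2 : deriv (phiFn V G β) p = deriv Phi a * deriv (Psi V G β) p :=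
      deriv_comp p (differentiable_Phi _) (differentiable_Psi _)
    rw [h1, mul_comm, ← h2]
    exact hsub.2.2
  have hmem : Set.Icc (a - S) (a + S) ∈ nhds a := Icc_mem_nhds (by linarith) (by linarith)
  have hcont : ContinuousOn (dslope g a) (Set.Icc (a - S) (a + S)) :=
    (continuousOn_dslope hmem).2 ⟨hdiff.continuous.continuousOn, hdiff a⟩
  have hlt : ∀ b, dslope g a b < 1 := by
    intro b
    rcases lt_trichotomy b a with h | rfl | h
    · rw [dslope_of_ne _ h.ne, slope_def_field, hga, div_lt_one_of_neg (by linarith)]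
      linarith [lt_Psi_Phi_sub hβ hsub h]
    · rwa [dslope_same]
    · rw [dslope_of_ne _ h.ne', slope_def_field, hga, div_lt_one (by linarith)]
      linarith [Psi_Phi_sub_lt hβ hsub h]
  obtain ⟨c, -, hc⟩ := isCompact_Icc.exists_isMaxOn (Set.nonempty_Icc.2 (by linarith)) hcont
  refine ⟨max (dslope g a c) 0, le_max_right _ _, max_lt (hlt c) one_pos, fun b hb => ?_⟩
  have hb' : b ∈ Set.Icc (a - S) (a + S) := by
    rw [abs_le] at hb
    exact ⟨by linarith, by linarith⟩
  have hle : dslope g a b ≤ max (dslope g a c) 0 := (hc hb').trans (le_max_left _ _)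
  have hmono : Monotone g := Psi_Phi_mono hβ
  have heq : g b - a = dslope g a b * (b - a) := by
    have := sub_smul_dslope g a b
    rw [hga, smul_eq_mul] at this
    linarith
  rcases le_total a b with h | h
  · have h1 := hmono h
    rw [hga] at h1
    rw [abs_of_nonneg (sub_nonneg.2 h1), abs_of_nonneg (sub_nonneg.2 h), heq]
    exact mul_le_mul_of_nonneg_right hle (sub_nonneg.2 h)
  · have h1 := hmono h
    rw [hga] at h1
    rw [abs_of_nonpos (sub_nonpos.2 h1), abs_of_nonpos (sub_nonpos.2 h), heq, ← mul_neg]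
    exact mul_le_mul_of_nonneg_right hle (by linarith)

lemma abs_Phi_sub_le (u v : ℝ) : |Phi u - Phi v| ≤ |u - v| := by
  have h := Convex.norm_image_sub_le_of_norm_deriv_le (f := Phi) (C := 1) (s := Set.univ)
    (x := v) (y := u) (fun x _ => differentiable_Phi x) (fun x _ => ?_) convex_univ
    (Set.mem_univ _) (Set.mem_univ _)
  · simpa using h
  · have : Phi = Real.sigmoid := funext Phi_eq_sigmoid
    rw [this, Real.deriv_sigmoid]
    have h0 := Real.sigmoid_nonneg x
    have h1 := Real.sigmoid_le_one x
    rw [Real.norm_eq_abs, abs_le]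
    constructor <;> nlinarith

end FixedPoint

section Bootstrap

variable {s : ℕ} {V : Fin s → ℕ} {G : ∀ i, SimpleGraph (Fin (V i))} {β : Fin s → ℝ} {p : ℝ}

/-- Bounds for the discrete derivatives of the Hamiltonian, uniform in the number of vertices. -/
lemma exists_uniform_bound (hβ : ∀ i, 0 < β i) (p : ℝ) :
    ∃ B : ℝ, 1 ≤ B ∧ ∀ n : ℕ, 2 ≤ n → ∀ e : EdgeSet n,
      (∀ x, |diffAt e (Hamiltonian V G β) x - Psi V G β p| ≤ B) ∧
      (∀ e', influence V G β e e' ≤ B / n) ∧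
      (∑ e', influence V G β e e' ^ 2 ≤ B ^ 2 / n) ∧
      ∀ q, 0 ≤ q → q ≤ 1 → ∃ m, |m - Psi V G β q| ≤ B / n ∧
        ∀ x, sweep q Finset.univ.toList (diffAt e (Hamiltonian V G β)) x = m := by
  set c₁ := ∑ i, β i * (2 * numEdges (G i) * (2 * (V i : ℝ) ^ 2 + 3))
  set c₂ := ∑ i, β i * (V i : ℝ) ^ 3
  set c₃ := ∑ i, β i * (2 * numEdges (G i) * (2 * (V i : ℝ) ^ 2 + 3)) * numEdges (G i)
  set c₄ := ∑ i, β i * (2 * numEdges (G i) * (2 * (V i : ℝ) ^ 2 + 2))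
  have h₁ : 0 ≤ c₁ := Finset.sum_nonneg fun i _ => by have := hβ i; positivity
  have h₂ : 0 ≤ c₂ := Finset.sum_nonneg fun i _ => by have := hβ i; positivity
  have h₃ : 0 ≤ c₃ := Finset.sum_nonneg fun i _ => by have := hβ i; positivity
  have h₄ : 0 ≤ c₄ := Finset.sum_nonneg fun i _ => by have := hβ i; positivity
  have h₅ := abs_nonneg (Psi V G β p)
  refine ⟨1 + c₁ + c₂ + c₃ + c₄ + |Psi V G β p|, by linarith, fun n hn e => ?_⟩
  set B := 1 + c₁ + c₂ + c₃ + c₄ + |Psi V G β p| with hB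
  have hn0 : (0 : ℝ) < n := by exact_mod_cast (by omega : 0 < n)
  have hinf : ∀ e', influence V G β e e' ≤ B / n := fun e' =>
    (influence_le V G hβ (by omega) e e').trans (by gcongr; linarith)
  refine ⟨fun x => ?_, hinf, ?_, fun q hq0 hq1 => ?_⟩
  · refine (abs_sub _ _).trans ?_
    rw [abs_of_nonneg (diffAt_hamiltonian_nonneg V G hβ e x)]
    linarith [diffAt_hamiltonian_le V G hβ hn e x]
  · calc ∑ e', influence V G β e e' ^ 2 ≤ ∑ e', B / n * influence V G β e e' := by
          refine Finset.sum_le_sum fun e' _ => ?_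
          rw [sq]
          exact mul_le_mul_of_nonneg_right (hinf e') (influence_nonneg V G hβ e e')
      _ = B / n * ∑ e', influence V G β e e' := by rw [Finset.mul_sum]
      _ ≤ B / n * B := by
          refine mul_le_mul_of_nonneg_left ?_ (by positivity)
          exact (sum_influence_le V G hβ hn e).trans (by linarith)
      _ = _ := by ring
  · refine ⟨_, (abs_sum_copies_sub_Psi_le V G hβ hn hq0 hq1 e).trans ?_,
      fun x => sweep_diffAt_hamiltonian V G q e x⟩
    gcongr
    linarith

/-- The probability, under the ERGM, that the discrete derivative at any given edge deviates by
more than `d` from `a` on either side is at most `δ`. -/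
def TailBound (n : ℕ) (V : Fin s → ℕ) (G : ∀ i, SimpleGraph (Fin (V i))) (β : Fin s → ℝ)
    (a d δ : ℝ) : Prop :=
  ∀ σ : ℝ, σ = 1 ∨ σ = -1 → ∀ e : EdgeSet n, ∑ x, gibbs (Hamiltonian V G β) x *
    beyond σ (a + σ * d) (diffAt e (Hamiltonian V G β)) x ≤ δ

lemma tailBound_of_forall_abs_sub_le {n : ℕ} {a d δ : ℝ} (hδ : 0 ≤ δ)
    (h : ∀ (e : EdgeSet n) x, |diffAt e (Hamiltonian V G β) x - a| ≤ d) :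
    TailBound n V G β a d δ := by
  intro σ hσ e
  refine le_of_eq_of_le (Finset.sum_eq_zero fun x _ => ?_) hδ
  have := abs_le.1 (h e x)
  rw [beyond, if_neg, mul_zero]
  rcases hσ with rfl | rfl <;> linarith

lemma TailBound.contract (hβ : ∀ i, 0 < β i) {a B ρ d : ℝ} {n : ℕ} (hn : 2 ≤ n) (hB : 1 ≤ B)
    (hbound : ∀ e : EdgeSet n,
      (∀ e', influence V G β e e' ≤ B / n) ∧
      (∑ e', influence V G β e e' ^ 2 ≤ B ^ 2 / n) ∧
      ∀ q, 0 ≤ q → q ≤ 1 → ∃ m, |m - Psi V G β q| ≤ B / n ∧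
        ∀ x, sweep q Finset.univ.toList (diffAt e (Hamiltonian V G β)) x = m)
    (hρ0 : 0 ≤ ρ) (hρ1 : ρ < 1)
    (hcontr : ∀ b, |b - a| ≤ B → |Psi V G β (Phi b) - a| ≤ ρ * |b - a|)
    {γ r κ : ℝ} (hγ : γ = (1 - ρ) / 4) (hr : r = (1 + ρ) / 2) (hκ : κ = γ ^ 2 / (4 * B ^ 2))
    (hd0 : 0 ≤ d) (hdB : d ≤ B) (hdn : B ≤ γ * d * n)
    (hlog : 2 * Real.log n ≤ κ * (1 - r ^ 2) * d ^ 2 * n)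
    (h : TailBound n V G β a d (Real.exp (-(κ * d ^ 2 * n)))) :
    TailBound n V G β a (r * d) (Real.exp (-(κ * (r * d) ^ 2 * n))) := by
  intro σ hσ e
  obtain ⟨hinf, hsq, hmean⟩ := hbound e
  have hn0 : (0 : ℝ) < n := by exact_mod_cast (by omega : 0 < n)
  have hB0 : 0 < B := by linarith
  have hγ0 : 0 < γ := by rw [hγ]; linarith
  have hσabs : |σ| = 1 := by rcases hσ with rfl | rfl <;> norm_num
  have hσsq : σ * σ = 1 := by rcases hσ with rfl | rfl <;> norm_num
  obtain ⟨m, hm, hmx⟩ := hmean _ (Phi_nonneg (a + σ * d)) (Phi_le_one _)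
  have hle : ∀ z : ℝ, σ * z ≤ |z| := fun z => by
    simpa [abs_mul, hσabs] using le_abs_self (σ * z)
  have hbd : |a + σ * d - a| = d := by
    rw [add_sub_cancel_left, abs_mul, hσabs, one_mul, abs_of_nonneg hd0]
  have hctr := hcontr (a + σ * d) (by rw [hbd]; exact hdB)
  rw [hbd] at hctr
  have hBn : B / n ≤ γ * d := by rw [div_le_iff₀ hn0]; exact hdn
  have hη : σ * (m - (a + σ * (r * d))) ≤ -(γ * d) := by
    have e1 : σ * (m - (a + σ * (r * d))) = σ * (m - Psi V G β (Phi (a + σ * d))) +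
        σ * (Psi V G β (Phi (a + σ * d)) - a) - r * d := by
      linear_combination (-(r * d)) * hσsq
    have e2 : r * d = ρ * d + 2 * (γ * d) := by rw [hr, hγ]; ring
    linarith [hle (m - Psi V G β (Phi (a + σ * d))), hle (Psi V G β (Phi (a + σ * d)) - a)]
  set t := γ * d * n / (2 * B ^ 2) with ht
  have ht0 : 0 ≤ t := by positivity
  have hstep := sum_gibbs_beyond_le (Hamiltonian V G β) hσ (h σ hσ) e
    (c := influence V G β e) (diffAt_diffAt_hamiltonian_nonneg V G hβ e)
    (diffAt_diffAt_hamiltonian_le V G hβ e) ht0 (fun e' => ?_) hsq hmx hη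
  · refine hstep.trans ?_
    have hexp : -(t * (γ * d)) + t ^ 2 * (B ^ 2 / n) = -(κ * d ^ 2 * n) := by
      rw [ht, hκ]; field_simp; ring
    have hM : (1 + Fintype.card (EdgeSet n) : ℝ) ≤ n ^ 2 := by
      rw [Sym2.card_subtype_not_diag, Fintype.card_fin, Nat.cast_choose_two]
      have : (2 : ℝ) ≤ n := by exact_mod_cast hn
      nlinarith
    have hn2 : (n : ℝ) ^ 2 = Real.exp (2 * Real.log n) := by
      rw [two_mul, Real.exp_add, Real.exp_log hn0, sq]
    rw [hexp, ← one_add_mul]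
    calc (1 + Fintype.card (EdgeSet n) : ℝ) * Real.exp (-(κ * d ^ 2 * n))
        ≤ Real.exp (2 * Real.log n) * Real.exp (-(κ * d ^ 2 * n)) := by
          rw [← hn2]; gcongr
      _ = Real.exp (2 * Real.log n - κ * d ^ 2 * n) := by rw [← Real.exp_add]; ring_nf
      _ ≤ _ := by
          rw [Real.exp_le_exp]
          nlinarith
  · calc t * influence V G β e e' ≤ t * (B / n) := mul_le_mul_of_nonneg_left (hinf e') ht0
      _ = γ * d / (2 * B) := by rw [ht]; field_simp
      _ ≤ 1 := by
          rw [div_le_one (by positivity)]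
          have : γ ≤ 1 := by rw [hγ]; linarith
          nlinarith

lemma exists_scale_of_contract {P : ℝ → Prop} {r S θ : ℝ} (hr0 : 0 < r) (hr1 : r < 1)
    (hθ : 0 < θ) (hθS : θ ≤ S) (hS : P S) (hstep : ∀ d, θ ≤ d → d ≤ S → P d → P (r * d)) :
    ∃ d, r * θ ≤ d ∧ d ≤ θ ∧ P d := by
  classical
  have hS0 : 0 < S := hθ.trans_le hθS
  have hex : ∃ j : ℕ, r ^ j * S < θ := by
    obtain ⟨j, hj⟩ := exists_pow_lt_of_lt_one (div_pos hθ hS0) hr1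
    exact ⟨j, (lt_div_iff₀ hS0).1 hj⟩
  have hP : ∀ i ≤ Nat.find hex, P (r ^ i * S) := by
    intro i
    induction i with
    | zero => simpa using hS
    | succ i ih =>
      intro hi
      have h1 := not_lt.1 (Nat.find_min hex (Nat.lt_of_succ_le hi))
      rw [pow_succ', mul_assoc]
      exact hstep _ h1 (mul_le_of_le_one_left hS0.le (pow_le_one₀ hr0.le hr1.le))
        (ih (Nat.le_of_succ_le hi))
  have hspec := Nat.find_spec hex
  obtain ⟨k, hk⟩ : ∃ k, Nat.find hex = k + 1 := by
    refine Nat.exists_eq_succ_of_ne_zero fun h0 => ?_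
    rw [h0] at hspec
    simp only [pow_zero, one_mul] at hspec
    linarith
  refine ⟨_, ?_, hspec.le, hP _ le_rfl⟩
  rw [hk, pow_succ', mul_assoc]
  exact mul_le_mul_of_nonneg_left (not_lt.1 (Nat.find_min hex (by omega))) hr0.le

lemma TailBound.abs_expect_edgeX_sub_le {n : ℕ} {a d δ : ℝ} (hd : 0 ≤ d)
    (h : TailBound n V G β a d δ) (e : EdgeSet n) :
    |expect (ergmProb V G β) (edgeX e) - Phi a| ≤ d + 2 * δ := by
  set H : Config n → ℝ := Hamiltonian V G β with hH
  have hmarg : expect (ergmProb V G β) (edgeX e) = ∑ x, gibbs H x * Phi (diffAt e H x) := by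
    change ∑ x, gibbs H x * edgeX e x = _
    rw [sum_gibbs_resample H e]
    simp [resample, edgeX]
  have hpt : ∀ x, |Phi (diffAt e H x) - Phi a| ≤
      d + beyond 1 (a + 1 * d) (diffAt e H) x + beyond (-1) (a + -1 * d) (diffAt e H) x := by
    intro x
    have hlip := abs_Phi_sub_le (diffAt e H x) a
    have h1 : |Phi (diffAt e H x) - Phi a| ≤ 1 := abs_le.2
      ⟨by linarith [Phi_nonneg (diffAt e H x), Phi_le_one a],
        by linarith [Phi_nonneg a, Phi_le_one (diffAt e H x)]⟩
    unfold beyond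
    split_ifs with h2 h3 h3
    · linarith
    · linarith
    · linarith
    · have : |diffAt e H x - a| ≤ d := abs_le.2 ⟨by linarith, by linarith⟩
      linarith
  have hdiff : expect (ergmProb V G β) (edgeX e) - Phi a =
      ∑ x, gibbs H x * (Phi (diffAt e H x) - Phi a) := by
    simp only [mul_sub, Finset.sum_sub_distrib, ← Finset.sum_mul, sum_gibbs, one_mul, hmarg]
  rw [hdiff]
  calc |∑ x, gibbs H x * (Phi (diffAt e H x) - Phi a)|
      ≤ ∑ x, gibbs H x * (d + beyond 1 (a + 1 * d) (diffAt e H) x +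
          beyond (-1) (a + -1 * d) (diffAt e H) x) := by
        refine (Finset.abs_sum_le_sum_abs _ _).trans (Finset.sum_le_sum fun x _ => ?_)
        rw [abs_mul, abs_of_nonneg (gibbs_nonneg H x)]
        exact mul_le_mul_of_nonneg_left (hpt x) (gibbs_nonneg H x)
    _ = d + ∑ x, gibbs H x * beyond 1 (a + 1 * d) (diffAt e H) x +
          ∑ x, gibbs H x * beyond (-1) (a + -1 * d) (diffAt e H) x := by
        simp only [mul_add, Finset.sum_add_distrib, ← Finset.sum_mul, sum_gibbs, one_mul]
    _ ≤ d + 2 * δ := by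
        linarith [h 1 (Or.inl rfl) e, h (-1) (Or.inr rfl) e]

end Bootstrap

/-- **(Proposition 7.3: the edge marginal is close to `p*`).**
If `β` is sub-critical with fixed point `p*`, there is `C > 0` such that for all
sufficiently large `n` and every edge `i`, `|𝔼 X_i - p*| ≤ C √(log n)/√n`. -/
theorem edge_marginal_close_to_pstar {s : ℕ} (V : Fin s → ℕ)
    (G : ∀ i, SimpleGraph (Fin (V i))) (β : Fin s → ℝ) (hβ : ∀ i, 0 < β i)
    (p : ℝ) (hsub : Subcritical V G β p) :
    ∃ C : ℝ, 0 < C ∧ ∃ N : ℕ, ∀ n : ℕ, N ≤ n → ∀ i : EdgeSet n,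
      |expect (ergmProb V G β) (edgeX i) - p| ≤
        C * Real.sqrt (Real.log n) / Real.sqrt n := by
  obtain ⟨B, hB, hbound⟩ := exists_uniform_bound (V := V) (G := G) hβ p
  have hB0 : 0 < B := by linarith
  obtain ⟨ρ, hρ0, hρ1, hcontr⟩ := exists_contraction hβ hsub hB0
  set γ := (1 - ρ) / 4 with hγ
  set r := (1 + ρ) / 2 with hr
  set κ := γ ^ 2 / (4 * B ^ 2) with hκ
  have hγ0 : 0 < γ := by rw [hγ]; linarith
  have hr0 : 0 < r := by rw [hr]; linarith
  have hr1 : r < 1 := by rw [hr]; linarith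
  have hr2 : 0 < 1 - r ^ 2 := by nlinarith
  have hκ0 : 0 < κ := by positivity
  set A := 1 + B / γ + 2 / (κ * (1 - r ^ 2)) + 1 / (κ * r ^ 2) with hA
  have p1 : 0 < B / γ := by positivity
  have p2 : 0 < 2 / (κ * (1 - r ^ 2)) := by positivity
  have p3 : 0 < 1 / (κ * r ^ 2) := by positivity
  have hA1 : 1 ≤ A := by linarith
  have hAA : A ≤ A ^ 2 := by nlinarith
  have hAB : B ≤ γ * A := by
    have : B / γ ≤ A := by linarith
    rwa [div_le_iff₀' hγ0] at this
  have hA2 : 2 ≤ κ * (1 - r ^ 2) * A ^ 2 := by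
    have : 2 / (κ * (1 - r ^ 2)) ≤ A ^ 2 := by linarith
    rwa [div_le_iff₀' (by positivity)] at this
  have hA3 : 1 ≤ κ * r ^ 2 * A ^ 2 := by
    have : 1 / (κ * r ^ 2) ≤ A ^ 2 := by linarith
    rwa [div_le_iff₀' (by positivity)] at this
  refine ⟨A + 2, by linarith, 3, fun n hn e => ?_⟩
  have hn3 : (3 : ℝ) ≤ n := by exact_mod_cast hn
  have hn0 : (0 : ℝ) < n := by linarith
  have hlog : 1 ≤ Real.log n := by
    rw [Real.le_log_iff_exp_le hn0]
    linarith [Real.exp_one_lt_d9]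
  set w := Real.sqrt (Real.log n) / Real.sqrt n with hw
  have hw0 : 0 < w := div_pos (Real.sqrt_pos.2 (by linarith)) (Real.sqrt_pos.2 hn0)
  have hwsq : w ^ 2 * n = Real.log n := by
    rw [hw, div_pow, Real.sq_sqrt (by linarith), Real.sq_sqrt hn0.le, div_mul_cancel₀ _ hn0.ne']
  have hwn : 1 ≤ w * n := by
    have h1 : 1 ≤ (w * n) ^ 2 := by
      have : (w * n) ^ 2 = Real.log n * n := by rw [← hwsq]; ring
      rw [this]; nlinarith
    exact (one_le_sq_iff₀ (by positivity)).1 h1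
  have hbound' := hbound n (by omega)
  have habs := fun e => (hbound' e).1
  obtain ⟨d, hd0, hdle, hd⟩ : ∃ d, 0 ≤ d ∧ d ≤ A * w ∧
      TailBound n V G β (Psi V G β p) d (1 / n) := by
    rcases le_total B (A * w) with h | h
    · exact ⟨B, hB0.le, h, tailBound_of_forall_abs_sub_le (by positivity) habs⟩
    obtain ⟨d, h1, h2, h3⟩ := exists_scale_of_contract
      (P := fun d => TailBound n V G β (Psi V G β p) d (Real.exp (-(κ * d ^ 2 * n))))
      hr0 hr1 (by positivity) h
      (tailBound_of_forall_abs_sub_le (Real.exp_pos _).le habs) (fun d hθd hdB hd => by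
        have hsq : A ^ 2 * w ^ 2 ≤ d ^ 2 := by
          rw [← mul_pow]; exact pow_le_pow_left₀ (by positivity) hθd 2
        refine hd.contract hβ (by omega) hB (fun e => (hbound' e).2) hρ0 hρ1 hcontr hγ hr hκ
          (le_trans (by positivity) hθd) hdB ?_ ?_
        · calc B ≤ γ * A * 1 := by linarith
            _ ≤ γ * A * (w * n) := by gcongr
            _ = γ * (A * w) * n := by ring
            _ ≤ γ * d * n := by gcongr
        · calc 2 * Real.log n ≤ κ * (1 - r ^ 2) * A ^ 2 * Real.log n := by gcongr
            _ = κ * (1 - r ^ 2) * (A ^ 2 * w ^ 2) * n := by rw [← hwsq]; ring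
            _ ≤ κ * (1 - r ^ 2) * d ^ 2 * n := by gcongr)
    refine ⟨d, le_trans (by positivity) h1, h2, fun σ hσ e => (h3 σ hσ e).trans ?_⟩
    rw [one_div, ← Real.exp_log (inv_pos.2 hn0), Real.log_inv, Real.exp_le_exp, neg_le_neg_iff]
    calc Real.log n ≤ κ * r ^ 2 * A ^ 2 * Real.log n := by
          exact le_mul_of_one_le_left (by linarith) hA3
      _ = κ * (r * (A * w)) ^ 2 * n := by rw [← hwsq]; ring
      _ ≤ κ * d ^ 2 * n := by gcongr
  have hfin := hd.abs_expect_edgeX_sub_le hd0 e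
  rw [Phi_Psi_fixedPoint hsub] at hfin
  have hinv : 1 / (n : ℝ) ≤ w := by rwa [div_le_iff₀ hn0]
  rw [mul_div_assoc]
  calc _ ≤ d + 2 * (1 / (n : ℝ)) := hfin
    _ ≤ A * w + 2 * w := by gcongr
    _ = (A + 2) * w := by ring

end ERGM
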